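/- arXiv:1112.1266 — 2 statements merged into one kernel-verified Lean document; each statement's English description precedes it below -/
import Mathlib

section
/- Let β be the unique real root greater than 1 of the polynomial X⁴ − 2X³ + X² − 2X + 1. Then for every finite subset A ⊆ ℂ with at least two elements, the relation language L(β, A) is not regular; that is, there is no finite digit set A of cardinality at least 2 for which the semigroup generated by the affine maps x ↦ βx + t, t ∈ A, is strongly automatic. -/
/-- Evaluation of a word `u₁ ⋯ uₙ` of digits as `∑ i, uᵢ β^(n - i)`. -/
def betaEval {k : Type*} [Field k] (β : k) (w : List k) : k :=
  w.foldl (fun acc a => β * acc + a) 0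

/-- The relation language `L(β, A)` over the alphabet `A × A`: words
`(u₁,v₁) ⋯ (uₙ,vₙ)` such that `∑ uᵢ β^(n-i) = ∑ vᵢ β^(n-i)` in `k`, i.e. the
corresponding compositions of the affine maps `x ↦ βx + t` agree. -/
def relLang {k : Type*} [Field k] (β : k) (A : Finset k) : Language (↥A × ↥A) :=
  { w | betaEval β (w.map fun p => (p.1 : k)) = betaEval β (w.map fun p => (p.2 : k)) }

/-- The two pairs of conjugates of the Salem number `β`: `β` and `β⁻¹` are the roots of
`X² - (1 + √2)X + 1`, and `α` lies on the unit circle and is a root of `X² - (1 - √2)X + 1`. -/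
structure IsSalemPair (β : ℝ) (α : ℂ) : Prop where
  one_lt : 1 < β
  sq_eq : β ^ 2 = (1 + √2) * β - 1
  sq_eq' : α ^ 2 = (1 - √2) * α - 1
  norm_eq : ‖α‖ = 1
  im_pos : 0 < α.im

theorem exists_isSalemPair {β : ℝ} (hβ : 1 < β)
    (hroot : β ^ 4 - 2 * β ^ 3 + β ^ 2 - 2 * β + 1 = 0) : ∃ α : ℂ, IsSalemPair β α := by
  have h2 : √2 ^ 2 = 2 := Real.sq_sqrt (by norm_num)
  have h1 : 1 < √2 := by rw [Real.lt_sqrt] <;> norm_num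
  have h3 : √2 < 3 / 2 := by rw [Real.sqrt_lt'] <;> norm_num
  have hpos : 0 < 1 - ((1 - √2) / 2) ^ 2 := by nlinarith
  set t := √(1 - ((1 - √2) / 2) ^ 2) with ht
  have ht2 : t ^ 2 = 1 - ((1 - √2) / 2) ^ 2 := Real.sq_sqrt hpos.le
  refine ⟨⟨(1 - √2) / 2, t⟩, hβ, ?_, ?_, ?_, Real.sqrt_pos.2 hpos⟩
  · have hf : (β ^ 2 - (1 + √2) * β + 1) * (β ^ 2 - (1 - √2) * β + 1) = 0 := by
      linear_combination hroot + (-β ^ 2) * h2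
    rcases mul_eq_zero.1 hf with h | h
    · linarith
    · nlinarith
  · apply Complex.ext
    · simp [pow_two]; nlinarith
    · simp [pow_two]; ring
  · rw [Complex.norm_def, Complex.normSq_mk, Real.sqrt_eq_one]
    nlinarith

namespace IsSalemPair

/-- The product of the real embeddings at `β` and `β⁻¹` and the complex embedding at `α`. -/
abbrev Emb := ℝ × ℝ × ℂ

/-- The image of the Salem number in `ℝ × ℝ × ℂ`. -/
noncomputable def gen (β : ℝ) (α : ℂ) : Emb := (β, β⁻¹, α)

/-- The image of `ℤ[β] = ℤ[√2] + ℤ[√2] β` in `ℝ × ℝ × ℂ`. -/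
noncomputable def lattice (β : ℝ) (α : ℂ) : AddSubgroup Emb where
  carrier := {D | ∃ p₀ p₁ q₀ q₁ : ℤ, D = ((p₀ + p₁ * √2) + (q₀ + q₁ * √2) * β,
    (p₀ + p₁ * √2) + (q₀ + q₁ * √2) * β⁻¹, (p₀ - p₁ * √2) + (q₀ - q₁ * √2) * α)}
  zero_mem' := ⟨0, 0, 0, 0, by simp [Prod.ext_iff]⟩
  add_mem' := by
    rintro _ _ ⟨p₀, p₁, q₀, q₁, rfl⟩ ⟨p₀', p₁', q₀', q₁', rfl⟩
    refine ⟨p₀ + p₀', p₁ + p₁', q₀ + q₀', q₁ + q₁', ?_⟩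
    ext1
    · push_cast; simp only [Prod.mk_add_mk]; ring
    · ext1 <;> (push_cast; simp only [Prod.mk_add_mk]; ring)
  neg_mem' := by
    rintro _ ⟨p₀, p₁, q₀, q₁, rfl⟩
    refine ⟨-p₀, -p₁, -q₀, -q₁, ?_⟩
    ext1
    · push_cast; simp only [Prod.neg_mk]; ring
    · ext1 <;> (push_cast; simp only [Prod.neg_mk]; ring)

theorem one_mem_lattice (β : ℝ) (α : ℂ) : 1 ∈ lattice β α :=
  ⟨1, 0, 0, 0, by simp [Prod.ext_iff]⟩

theorem int_eq_zero_of_add_mul_sqrt_two {m n : ℤ} (h : (m : ℝ) + n * √2 = 0) :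
    m = 0 ∧ n = 0 := by
  have hn : n = 0 := by
    by_contra hn
    have hn' : (n : ℝ) ≠ 0 := by exact_mod_cast hn
    refine irrational_sqrt_two ⟨(-m / n : ℚ), ?_⟩
    push_cast
    field_simp
    linarith
  subst hn
  refine ⟨?_, rfl⟩
  simpa using h

variable {β : ℝ} {α : ℂ}

theorem inv_sq_eq (h : IsSalemPair β α) : β⁻¹ ^ 2 = (1 + √2) * β⁻¹ - 1 := by
  have h0 : β ≠ 0 := by linarith [h.one_lt]
  have := h.sq_eq
  field_simp
  linarith

theorem add_inv_eq (h : IsSalemPair β α) : β + β⁻¹ = 1 + √2 := by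
  have h0 : β ≠ 0 := by linarith [h.one_lt]
  have := h.sq_eq
  field_simp
  linarith

theorem lt_two (h : IsSalemPair β α) : β < 2 := by
  have h3 : √2 < 3 / 2 := by rw [Real.sqrt_lt'] <;> norm_num
  nlinarith [h.sq_eq, h.one_lt]

theorem gen_mul_mem_lattice (h : IsSalemPair β α) {D : Emb} (hD : D ∈ lattice β α) :
    gen β α * D ∈ lattice β α := by
  obtain ⟨p₀, p₁, q₀, q₁, rfl⟩ := hD
  have h2 : √2 ^ 2 = 2 := Real.sq_sqrt (by norm_num)
  have h2' : (√2 : ℂ) ^ 2 = 2 := by exact_mod_cast h2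
  refine ⟨-q₀, -q₁, p₀ + q₀ + 2 * q₁, p₁ + q₀ + q₁, ?_⟩
  simp only [gen]
  ext1
  · simp only [Prod.mk_mul_mk]; push_cast
    linear_combination (q₀ + q₁ * √2) * h.sq_eq + q₁ * β * h2
  · ext1
    · simp only [Prod.mk_mul_mk]; push_cast
      linear_combination (q₀ + q₁ * √2) * h.inv_sq_eq + q₁ * β⁻¹ * h2
    · simp only [Prod.mk_mul_mk]; push_cast
      linear_combination (q₀ - q₁ * √2) * h.sq_eq' + q₁ * α * h2'

theorem gen_pow_mem_lattice (h : IsSalemPair β α) (n : ℕ) : gen β α ^ n ∈ lattice β α := by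
  induction n with
  | zero => simpa using one_mem_lattice β α
  | succ n ih => rw [pow_succ']; exact h.gen_mul_mem_lattice ih

theorem eq_zero_of_fst_eq_zero (h : IsSalemPair β α) {D : Emb} (hD : D ∈ lattice β α)
    (h0 : D.1 = 0) : D = 0 := by
  obtain ⟨p₀, p₁, q₀, q₁, rfl⟩ := hD
  have h2 : √2 ^ 2 = 2 := Real.sq_sqrt (by norm_num)
  have h1 : 1 < √2 := by rw [Real.lt_sqrt] <;> norm_num
  have h3 : √2 < 3 / 2 := by rw [Real.sqrt_lt'] <;> norm_num
  have hb : β * β⁻¹ = 1 := mul_inv_cancel₀ (by linarith [h.one_lt])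
  simp only at h0
  have key := int_eq_zero_of_add_mul_sqrt_two
    (m := p₀ ^ 2 + 2 * p₁ ^ 2 + (p₀ * q₀ + 2 * p₁ * q₁) + 2 * (p₀ * q₁ + p₁ * q₀)
      + q₀ ^ 2 + 2 * q₁ ^ 2)
    (n := 2 * p₀ * p₁ + (p₀ * q₁ + p₁ * q₀) + (p₀ * q₀ + 2 * p₁ * q₁) + 2 * q₀ * q₁) (by
      push_cast
      linear_combination (p₀ + p₁ * √2 + (q₀ + q₁ * √2) * β⁻¹) * h0
        - (q₀ + q₁ * √2) ^ 2 * hb - (p₀ + p₁ * √2) * (q₀ + q₁ * √2) * h.add_inv_eq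
        - (p₁ ^ 2 + q₁ ^ 2 + p₁ * q₁ + (p₀ * q₁ + p₁ * q₀) + p₁ * q₁ * √2) * h2)
  obtain ⟨hm, hn⟩ := key
  have hm' : (p₀ ^ 2 + 2 * p₁ ^ 2 + (p₀ * q₀ + 2 * p₁ * q₁) + 2 * (p₀ * q₁ + p₁ * q₀)
      + q₀ ^ 2 + 2 * q₁ ^ 2 : ℝ) = 0 := by exact_mod_cast hm
  have hn' : (2 * p₀ * p₁ + (p₀ * q₁ + p₁ * q₀) + (p₀ * q₀ + 2 * p₁ * q₁) +
      2 * q₀ * q₁ : ℝ) = 0 := by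
    exact_mod_cast hn
  have hform : (p₀ - p₁ * √2) ^ 2 + (p₀ - p₁ * √2) * (q₀ - q₁ * √2) * (1 - √2)
      + (q₀ - q₁ * √2 : ℝ) ^ 2 = 0 := by
    linear_combination hm' - √2 * hn' +
      (p₁ ^ 2 + q₁ ^ 2 + p₁ * q₁ + (p₀ * q₁ + p₁ * q₀) - p₁ * q₁ * √2) * h2
  generalize hP : (p₀ - p₁ * √2 : ℝ) = P at hform
  generalize hQ : (q₀ - q₁ * √2 : ℝ) = Q at hform
  have hsum : P ^ 2 + Q ^ 2 ≤ 0 := by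
    nlinarith [mul_nonneg (by linarith : 0 ≤ √2 - 1) (sq_nonneg (P - Q)),
      mul_nonneg (by linarith : 0 ≤ 3 / 2 - √2) (sq_nonneg (P - Q)), sq_nonneg P, sq_nonneg Q,
      mul_nonneg (by linarith : 0 ≤ √2 - 1) (sq_nonneg (P + Q)),
      mul_nonneg (by linarith : 0 ≤ 3 / 2 - √2) (add_nonneg (sq_nonneg P) (sq_nonneg Q))]
  have hP0 : P = 0 := by nlinarith [sq_nonneg P, sq_nonneg Q]
  have hQ0 : Q = 0 := by nlinarith [sq_nonneg P, sq_nonneg Q]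
  obtain ⟨rfl, hp⟩ := int_eq_zero_of_add_mul_sqrt_two (m := p₀) (n := -p₁)
    (by push_cast; linarith)
  obtain ⟨rfl, hq⟩ := int_eq_zero_of_add_mul_sqrt_two (m := q₀) (n := -q₁)
    (by push_cast; linarith)
  obtain rfl : p₁ = 0 := by lia
  obtain rfl : q₁ = 0 := by lia
  simp

theorem eq_zero_of_snd_snd_eq_zero (h : IsSalemPair β α) {D : Emb} (hD : D ∈ lattice β α)
    (h0 : D.2.2 = 0) : D = 0 := by
  obtain ⟨p₀, p₁, q₀, q₁, rfl⟩ := hD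
  simp only at h0
  have hi := congrArg Complex.im h0
  have hr := congrArg Complex.re h0
  simp at hi hr
  have hQ : (q₀ - q₁ * √2 : ℝ) = 0 := by
    rcases hi with hi | hi
    · exact hi
    · exact absurd hi h.im_pos.ne'
  rw [hQ] at hr
  obtain ⟨rfl, hp⟩ := int_eq_zero_of_add_mul_sqrt_two (m := p₀) (n := -p₁)
    (by push_cast; linarith)
  obtain ⟨rfl, hq⟩ := int_eq_zero_of_add_mul_sqrt_two (m := q₀) (n := -q₁)
    (by push_cast; linarith)
  obtain rfl : p₁ = 0 := by lia
  obtain rfl : q₁ = 0 := by lia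
  simp

theorem re_eq (h : IsSalemPair β α) : α.re = (1 - √2) / 2 := by
  have hi := congrArg Complex.im h.sq_eq'
  simp [pow_two] at hi
  have : α.im * (2 * α.re - (1 - √2)) = 0 := by linarith
  rcases mul_eq_zero.1 this with h' | h'
  · exact absurd h' h.im_pos.ne'
  · linarith

theorem half_le_im (h : IsSalemPair β α) : 1 / 2 ≤ α.im := by
  have h3 : √2 < 3 / 2 := by rw [Real.sqrt_lt'] <;> norm_num
  have h1 : 1 < √2 := by rw [Real.lt_sqrt] <;> norm_num
  have hn : α.re ^ 2 + α.im ^ 2 = 1 := by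
    have := Complex.sq_norm α
    rw [h.norm_eq, Complex.normSq_apply] at this
    linarith
  rw [h.re_eq] at hn
  nlinarith [h.im_pos]

theorem eq_zero_of_small (h : IsSalemPair β α) {D : Emb} (hD : D ∈ lattice β α)
    (hx : |D.1| ≤ 1 / 16) (hy : |D.2.1| ≤ 1 / 16) (hr : |D.2.2.re| ≤ 1 / 16)
    (hi : |D.2.2.im| ≤ 1 / 16) : D = 0 := by
  have h1 : 1 < √2 := by rw [Real.lt_sqrt] <;> norm_num
  have h2 : √2 ^ 2 = 2 := Real.sq_sqrt (by norm_num)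
  have h3 : √2 < 3 / 2 := by rw [Real.sqrt_lt'] <;> norm_num
  have hb1 := h.one_lt
  have hb2 := h.lt_two
  have hbi : β * β⁻¹ = 1 := mul_inv_cancel₀ (by linarith [h.one_lt])
  have hgap : 1 ≤ β - β⁻¹ := by
    have hlt : β⁻¹ < 1 := inv_lt_one_of_one_lt₀ hb1
    have : (β - β⁻¹) ^ 2 = 2 * √2 - 1 := by
      linear_combination (β + β⁻¹ + 1 + √2) * h.add_inv_eq - 4 * hbi + h2
    nlinarith
  obtain ⟨p₀, p₁, q₀, q₁, rfl⟩ := hD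
  simp [-map_mul, -abs_mul] at hx hy hr hi
  rw [h.re_eq] at hr
  have him := h.half_le_im
  generalize hP : (p₀ + p₁ * √2 : ℝ) = P at hx hy
  generalize hQ : (q₀ + q₁ * √2 : ℝ) = Q at hx hy
  generalize hP' : (p₀ - p₁ * √2 : ℝ) = P' at hr hi
  generalize hQ' : (q₀ - q₁ * √2 : ℝ) = Q' at hr hi
  have abs_le_of_mul {a c e : ℝ} (hc : 0 < c) (hac : |a * c| ≤ c * e) : |a| ≤ e := by
    rw [abs_mul, abs_of_pos hc, mul_comm] at hac
    exact le_of_mul_le_mul_left hac hc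
  have hQb : |Q| ≤ 1 / 8 := by
    refine abs_le_of_mul (c := β - β⁻¹) (by linarith) ?_
    rw [show Q * (β - β⁻¹) = (P + Q * β) - (P + Q * β⁻¹) by ring]
    refine (abs_sub _ _).trans ?_
    linarith
  have hQb' : |Q'| ≤ 1 / 8 := by
    refine abs_le_of_mul h.im_pos ?_
    linarith
  have hPb : |P| ≤ 5 / 16 := by
    have h4 : |Q * β| ≤ 1 / 8 * 2 := by
      rw [abs_mul, abs_of_pos (by linarith : 0 < β)]; gcongr
    rw [abs_le] at *
    constructor <;> linarith
  have hPb' : |P'| ≤ 5 / 16 := by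
    have h4 : |Q' * ((1 - √2) / 2)| ≤ 1 / 8 * 2 := by
      rw [abs_mul]; gcongr
      rw [abs_le]; constructor <;> linarith
    rw [abs_le] at *
    constructor <;> linarith
  rw [abs_le] at hPb hPb' hQb hQb'
  have int_zero : ∀ {m : ℤ}, (-1 : ℝ) < m → (m : ℝ) < 1 → m = 0 := by
    intro m hm hm'
    have e1 : -1 < m := by exact_mod_cast hm
    have e2 : m < 1 := by exact_mod_cast hm'
    lia
  obtain rfl : p₀ = 0 := int_zero (by linarith) (by linarith)
  obtain rfl : q₀ = 0 := int_zero (by linarith) (by linarith)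
  push_cast at hP hQ
  obtain rfl : p₁ = 0 := int_zero
    (by by_contra! hc; nlinarith) (by by_contra! hc; nlinarith)
  obtain rfl : q₁ = 0 := int_zero
    (by by_contra! hc; nlinarith) (by by_contra! hc; nlinarith)
  push_cast at hP hQ
  simp [Prod.ext_iff, ← hP, ← hQ]

theorem im_pow_ne_zero (h : IsSalemPair β α) {r : ℕ} (hr : r ≠ 0) : (α ^ r).im ≠ 0 := by
  intro him
  have hre : (α ^ r).re = 1 ∨ (α ^ r).re = -1 := by
    have hn : ‖α ^ r‖ = 1 := by rw [norm_pow, h.norm_eq, one_pow]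
    rw [Complex.norm_eq_sqrt_sq_add_sq, him, Real.sqrt_eq_one] at hn
    exact sq_eq_one_iff.1 (by linarith)
  have hpow := one_lt_pow₀ h.one_lt hr
  rcases hre with hre | hre
  · have hz : α ^ r = 1 := Complex.ext (by simpa using hre) (by simpa using him)
    have := h.eq_zero_of_snd_snd_eq_zero
      (sub_mem (h.gen_pow_mem_lattice r) (one_mem_lattice β α)) (by simp [gen, hz])
    have := congrArg Prod.fst this
    simp [gen] at this
    linarith
  · have hz : α ^ r = -1 := Complex.ext (by simpa using hre) (by simpa using him)
    have := h.eq_zero_of_snd_snd_eq_zero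
      (add_mem (h.gen_pow_mem_lattice r) (one_mem_lattice β α)) (by simp [gen, hz])
    have := congrArg Prod.fst this
    simp [gen] at this
    linarith

end IsSalemPair

section DigitValues

variable {R : Type*} [CommRing R]

open Classical in
/-- The values in base `b` of the words of length `n` over the digits `0` and `1`. -/
noncomputable def digitValues (b : R) : ℕ → Finset R
  | 0 => {0}
  | n + 1 => (digitValues b n).image (b * ·) ∪ (digitValues b n).image (b * · + 1)

theorem mem_digitValues_zero {b x : R} : x ∈ digitValues b 0 ↔ x = 0 := by
  simp [digitValues]

theorem mem_digitValues_succ {b x : R} {n : ℕ} :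
    x ∈ digitValues b (n + 1) ↔ ∃ y ∈ digitValues b n, ∃ e : R, (e = 0 ∨ e = 1) ∧ x = b * y + e := by
  simp only [digitValues, Finset.mem_union, Finset.mem_image]
  constructor
  · rintro (⟨y, hy, rfl⟩ | ⟨y, hy, rfl⟩)
    · exact ⟨y, hy, 0, .inl rfl, by simp⟩
    · exact ⟨y, hy, 1, .inr rfl, rfl⟩
  · rintro ⟨y, hy, e, rfl | rfl, rfl⟩
    · exact .inl ⟨y, hy, by simp⟩
    · exact .inr ⟨y, hy, rfl⟩

theorem step_mem_digitValues {b y e : R} {n : ℕ} (hy : y ∈ digitValues b n)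
    (he : e = 0 ∨ e = 1) : b * y + e ∈ digitValues b (n + 1) :=
  mem_digitValues_succ.2 ⟨y, hy, e, he, rfl⟩

theorem pow_mul_add_mem_digitValues {b x p : R} {m n : ℕ} (hx : x ∈ digitValues b m)
    (hp : p ∈ digitValues b n) : b ^ n * x + p ∈ digitValues b (m + n) := by
  induction n generalizing p with
  | zero => rw [mem_digitValues_zero] at hp; simpa [hp] using hx
  | succ n ih =>
    obtain ⟨q, hq, e, he, rfl⟩ := mem_digitValues_succ.1 hp
    have := step_mem_digitValues (ih hq) he
    rwa [show b * (b ^ n * x + q) + e = b ^ (n + 1) * x + (b * q + e) by ring] at this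

/-- Words with the values `x` and `x'` have extensions by words of the same length with equal
values. -/
def Collide (b x x' : R) : Prop :=
  ∃ m, ∃ p ∈ digitValues b m, ∃ p' ∈ digitValues b m, b ^ m * x + p = b ^ m * x' + p'

theorem Collide.of_pow_mul_add {b x x' p p' : R} {n : ℕ} (hp : p ∈ digitValues b n)
    (hp' : p' ∈ digitValues b n) (h : Collide b (b ^ n * x + p) (b ^ n * x' + p')) :
    Collide b x x' := by
  obtain ⟨m, q, hq, q', hq', h⟩ := h
  refine ⟨n + m, _, pow_mul_add_mem_digitValues hp hq, _, pow_mul_add_mem_digitValues hp' hq', ?_⟩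
  linear_combination h

theorem Collide.of_add_left {b a x x' : R}
    (h : Collide b (a + x) (a + x')) : Collide b x x' := by
  obtain ⟨m, p, hp, p', hp', h⟩ := h
  exact ⟨m, p, hp, p', hp', by linear_combination h⟩

theorem Collide.refl (b x : R) : Collide b x x :=
  ⟨0, 0, mem_digitValues_zero.2 rfl, 0, mem_digitValues_zero.2 rfl, rfl⟩

theorem Collide.symm {b x x' : R} (h : Collide b x x') : Collide b x' x := by
  obtain ⟨m, p, hp, p', hp', h⟩ := h
  exact ⟨m, p', hp', p, hp, h.symm⟩

/-- If the differences of colliding values lie in `Δ`, the number of values of words is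
supermultiplicative up to the factor `#Δ`. -/
theorem card_mul_card_digitValues_le {b : R} (Δ : Finset R)
    (hΔ : ∀ n, ∀ x ∈ digitValues b n, ∀ x' ∈ digitValues b n, Collide b x x' → x - x' ∈ Δ)
    (m n : ℕ) : (digitValues b m).card * (digitValues b n).card ≤
      Δ.card * (digitValues b (m + n)).card := by
  classical
  rw [← Finset.card_product]
  refine Finset.card_le_mul_card_image_of_maps_to (f := fun z : R × R => b ^ n * z.1 + z.2)
    (fun z hz => ?_) _ (fun v _ => ?_)
  · rw [Finset.mem_product] at hz
    exact pow_mul_add_mem_digitValues hz.1 hz.2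
  · rcases Finset.eq_empty_or_nonempty
      {z ∈ digitValues b m ×ˢ digitValues b n | b ^ n * z.1 + z.2 = v} with h0 | ⟨z₀, hz₀⟩
    · rw [h0]; simp
    · rw [Finset.mem_filter, Finset.mem_product] at hz₀
      refine Finset.card_le_card_of_injOn (fun z => z.1 - z₀.1) (fun z hz => ?_) ?_
      · rw [Finset.mem_coe, Finset.mem_filter, Finset.mem_product] at hz
        exact hΔ m _ hz.1.1 _ hz₀.1.1
          ⟨n, _, hz.1.2, _, hz₀.1.2, hz.2.trans hz₀.2.symm⟩
      · intro z hz z' hz' hzz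
        rw [Finset.mem_coe, Finset.mem_filter] at hz hz'
        have h1 : z.1 = z'.1 := sub_left_injective hzz
        refine Prod.ext h1 ?_
        have := hz.2.trans hz'.2.symm
        rw [h1] at this
        exact add_left_cancel this

theorem card_digitValues_pow_le {b : R} (Δ : Finset R)
    (hΔ : ∀ n, ∀ x ∈ digitValues b n, ∀ x' ∈ digitValues b n, Collide b x x' → x - x' ∈ Δ)
    (n r : ℕ) : (digitValues b n).card ^ r ≤ Δ.card ^ r * (digitValues b (r * n)).card := by
  induction r with
  | zero => simp [digitValues]
  | succ r ih =>
    calc (digitValues b n).card ^ (r + 1)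
        ≤ (Δ.card ^ r * (digitValues b (r * n)).card) * (digitValues b n).card := by
          rw [pow_succ]; gcongr
      _ = Δ.card ^ r * ((digitValues b (r * n)).card * (digitValues b n).card) := by ring
      _ ≤ Δ.card ^ r * (Δ.card * (digitValues b (r * n + n)).card) := by
          exact Nat.mul_le_mul_left _ (card_mul_card_digitValues_le Δ hΔ _ _)
      _ = _ := by rw [Nat.succ_mul]; ring

end DigitValues

open MeasureTheory in
theorem natCast_mul_measure_le_card_mul {X ι : Type*} [MeasurableSpace X] (μ : Measure X)
    (V : Finset ι) (W : ι → Set X) (hW : ∀ v ∈ V, MeasurableSet (W v)) {c : ENNReal}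
    (hc : ∀ v ∈ V, μ (W v) ≤ c) (T : Set X) (k : ℕ)
    (hT : ∀ t ∈ T, ∃ s ⊆ V, s.card = k ∧ ∀ v ∈ s, t ∈ W v) : k * μ T ≤ V.card * c := by
  classical
  have hm : Measurable fun t => ∑ v ∈ V, (W v).indicator (1 : X → ENNReal) t :=
    Finset.measurable_fun_sum _ fun v hv => measurable_one.indicator (hW v hv)
  calc k * μ T ≤ k * μ {t | (k : ENNReal) ≤ ∑ v ∈ V, (W v).indicator (1 : X → ENNReal) t} := by
        gcongr
        intro t ht
        obtain ⟨s, hsV, rfl, hs⟩ := hT t ht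
        calc (s.card : ENNReal) = ∑ v ∈ s, (W v).indicator (1 : X → ENNReal) t := by
              rw [Finset.sum_congr rfl fun v hv => Set.indicator_of_mem (hs v hv) _]
              simp
          _ ≤ _ := Finset.sum_le_sum_of_subset hsV
    _ ≤ ∫⁻ t, ∑ v ∈ V, (W v).indicator (1 : X → ENNReal) t ∂μ :=
        mul_meas_ge_le_lintegral hm _
    _ = ∑ v ∈ V, μ (W v) := by
        rw [lintegral_finsetSum _ fun v hv => measurable_one.indicator (hW v hv)]
        exact Finset.sum_congr rfl fun v hv => lintegral_indicator_one (hW v hv)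
    _ ≤ V.card * c := by
        rw [← nsmul_eq_mul]
        exact Finset.sum_le_card_nsmul _ _ _ hc

namespace IsSalemPair

variable {β : ℝ} {α : ℂ}

theorem mem_lattice_of_mem_digitValues (h : IsSalemPair β α) {n : ℕ} {x : Emb}
    (hx : x ∈ digitValues (gen β α) n) : x ∈ lattice β α := by
  induction n generalizing x with
  | zero => rw [mem_digitValues_zero.1 hx]; exact zero_mem _
  | succ n ih =>
    obtain ⟨y, hy, e, he, rfl⟩ := mem_digitValues_succ.1 hx
    refine add_mem (h.gen_mul_mem_lattice (ih hy)) ?_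
    rcases he with rfl | rfl
    · exact zero_mem _
    · exact one_mem_lattice β α

theorem digitValues_bounds (h : IsSalemPair β α) {n : ℕ} {x : Emb}
    (hx : x ∈ digitValues (gen β α) n) :
    0 ≤ x.1 ∧ (β - 1) * x.1 ≤ β ^ n ∧ 0 ≤ x.2.1 ∧ (β - 1) * x.2.1 ≤ β ∧ ‖x.2.2‖ ≤ n := by
  have hb := h.one_lt
  have hbi : β * β⁻¹ = 1 := mul_inv_cancel₀ (by linarith)
  have hi : 0 ≤ β⁻¹ := by positivity
  suffices 0 ≤ x.1 ∧ (β - 1) * x.1 ≤ β ^ n - 1 ∧ 0 ≤ x.2.1 ∧ (β - 1) * x.2.1 ≤ β ∧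
      ‖x.2.2‖ ≤ n from ⟨this.1, this.2.1.trans (by linarith), this.2.2⟩
  induction n generalizing x with
  | zero => rw [mem_digitValues_zero.1 hx]; simp; linarith
  | succ n ih =>
    obtain ⟨y, hy, e, he, rfl⟩ := mem_digitValues_succ.1 hx
    obtain ⟨h1, h2, h3, h4, h5⟩ := ih hy
    have e1 : 0 ≤ e.1 ∧ e.1 ≤ 1 ∧ 0 ≤ e.2.1 ∧ e.2.1 ≤ 1 ∧ ‖e.2.2‖ ≤ 1 := by
      rcases he with rfl | rfl <;> simp
    obtain ⟨g1, g2, g3, g4, g5⟩ := e1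
    simp only [gen, Prod.fst_add, Prod.fst_mul, Prod.snd_add, Prod.snd_mul]
    refine ⟨by positivity, ?_, by positivity, ?_, ?_⟩
    · rw [pow_succ]
      nlinarith
    · have : (β - 1) * (β⁻¹ * y.2.1) ≤ 1 := by
        calc (β - 1) * (β⁻¹ * y.2.1) = β⁻¹ * ((β - 1) * y.2.1) := by ring
          _ ≤ β⁻¹ * β := by gcongr
          _ = 1 := by linarith
      nlinarith
    · refine (norm_add_le _ _).trans ?_
      rw [norm_mul, h.norm_eq]
      push_cast
      linarith

theorem exists_card_digitValues_le (h : IsSalemPair β α) :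
    ∃ C : ℝ, ∀ n : ℕ, ((digitValues (gen β α) n).card : ℝ) ≤ C * (n + 1) ^ 2 * β ^ n := by
  have hb := h.one_lt
  set L := (β - 1)⁻¹ with hL
  have hL0 : 0 < L := inv_pos.2 (by linarith)
  have hLb : ∀ {a c : ℝ}, (β - 1) * a ≤ c → a ≤ L * c := by
    intro a c hac
    rw [hL, ← div_eq_inv_mul, le_div_iff₀ (by linarith)]
    linarith
  refine ⟨(16 * L + 1) * (16 * (L * β) + 1) * 33 ^ 2, fun n => ?_⟩
  have hbn : 1 ≤ β ^ n := one_le_pow₀ hb.le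
  let B : Finset (ℤ × ℤ × ℤ × ℤ) := Finset.Icc 0 ⌊16 * (L * β ^ n)⌋ ×ˢ
    Finset.Icc 0 ⌊16 * (L * β)⌋ ×ˢ Finset.Icc (-(16 * (n : ℤ))) (16 * n) ×ˢ
    Finset.Icc (-(16 * (n : ℤ))) (16 * n)
  have hcard : (digitValues (gen β α) n).card ≤ B.card := by
    refine Finset.card_le_card_of_injOn
      (fun x => (⌊16 * x.1⌋, ⌊16 * x.2.1⌋, ⌊16 * x.2.2.re⌋, ⌊16 * x.2.2.im⌋)) ?_ ?_
    · intro x hx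
      obtain ⟨h1, h2, h3, h4, h5⟩ := h.digitValues_bounds hx
      have hr := abs_le.1 ((Complex.abs_re_le_norm _).trans h5)
      have hi := abs_le.1 ((Complex.abs_im_le_norm _).trans h5)
      have h2' := hLb h2
      have h4' := hLb h4
      have hfl : ∀ {t : ℝ}, -(n : ℝ) ≤ t → t ≤ n → -(16 * (n : ℤ)) ≤ ⌊16 * t⌋ ∧
          ⌊16 * t⌋ ≤ 16 * (n : ℤ) := by
        intro t ht ht'
        refine ⟨Int.le_floor.2 (by push_cast; linarith), ?_⟩
        have := (Int.floor_le (16 * t)).trans (by linarith : 16 * t ≤ 16 * n)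
        exact_mod_cast this
      simp only [B, Finset.coe_product, Set.mem_prod, Finset.mem_coe, Finset.mem_Icc]
      exact ⟨⟨Int.floor_nonneg.2 (by linarith), Int.floor_le_floor (by linarith)⟩,
        ⟨Int.floor_nonneg.2 (by linarith), Int.floor_le_floor (by linarith)⟩,
        hfl hr.1 hr.2, hfl hi.1 hi.2⟩
    · intro x hx y hy hxy
      simp only [Prod.mk.injEq] at hxy
      obtain ⟨h1, h2, h3, h4⟩ := hxy
      have hfl : ∀ {s t : ℝ}, ⌊16 * s⌋ = ⌊16 * t⌋ → |s - t| ≤ 1 / 16 := by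
        intro s t hst
        have := Int.abs_sub_lt_one_of_floor_eq_floor hst
        rw [← mul_sub, abs_mul, abs_of_pos (by norm_num : (0 : ℝ) < 16)] at this
        linarith
      have := h.eq_zero_of_small (sub_mem (h.mem_lattice_of_mem_digitValues hx)
        (h.mem_lattice_of_mem_digitValues hy)) (hfl h1) (hfl h2) (hfl h3) (hfl h4)
      exact sub_eq_zero.1 this
  have hB : (B.card : ℝ) ≤ (16 * (L * β ^ n) + 1) * ((16 * (L * β) + 1) *
      ((32 * n + 1) * (32 * n + 1))) := by
    have c1 : ∀ t : ℝ, 0 ≤ t → ((Finset.Icc 0 ⌊t⌋).card : ℝ) ≤ t + 1 := by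
      intro t ht
      rw [Int.card_Icc]
      have h0 : 0 ≤ ⌊t⌋ + 1 - 0 := by have := Int.floor_nonneg.2 ht; lia
      have : (((⌊t⌋ + 1 - 0).toNat : ℤ) : ℝ) ≤ t + 1 := by
        rw [Int.toNat_of_nonneg h0]
        push_cast
        linarith [Int.floor_le t]
      exact_mod_cast this
    have c2 : ((Finset.Icc (-(16 * (n : ℤ))) (16 * n)).card : ℝ) ≤ 32 * n + 1 := by
      rw [Int.card_Icc]
      have : (16 * (n : ℤ) + 1 - -(16 * n)).toNat = 32 * n + 1 := by lia
      rw [this]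
      push_cast
      exact le_rfl
    simp only [B, Finset.card_product]
    push_cast
    gcongr
    · exact c1 _ (by positivity)
    · exact c1 _ (by positivity)
  calc ((digitValues (gen β α) n).card : ℝ) ≤ B.card := by exact_mod_cast hcard
    _ ≤ _ := hB
    _ ≤ ((16 * L + 1) * β ^ n) * ((16 * (L * β) + 1) *
      ((33 * (n + 1)) * (33 * (n + 1)))) := by
        gcongr
        · nlinarith
        all_goals linarith
    _ = _ := by ring

theorem card_digitValues_le (h : IsSalemPair β α) (Δ : Finset Emb)
    (hΔ : ∀ n, ∀ x ∈ digitValues (gen β α) n, ∀ x' ∈ digitValues (gen β α) n,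
      Collide (gen β α) x x' → x - x' ∈ Δ) (n : ℕ) :
    ((digitValues (gen β α) n).card : ℝ) ≤ Δ.card * β ^ n := by
  have hb := h.one_lt
  obtain ⟨C, hC⟩ := h.exists_card_digitValues_le
  by_contra! hlt
  set V : ℝ := ((digitValues (gen β α) n).card : ℝ) with hV
  have hΔ0 : 0 < (Δ.card : ℝ) := by
    have : (0 : Emb) ∈ Δ := by
      simpa using hΔ 0 0 (mem_digitValues_zero.2 rfl) 0 (mem_digitValues_zero.2 rfl)
        (Collide.refl _ _)
    exact_mod_cast Finset.card_pos.2 ⟨_, this⟩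
  have hpos : 0 < Δ.card * β ^ n := by positivity
  set q := V / (Δ.card * β ^ n) with hq
  have hq1 : 1 < q := (one_lt_div hpos).2 hlt
  have hbound : ∀ r : ℕ, q ^ r ≤ C * ((n + 1) ^ 2 * (r + 1) ^ 2) := by
    intro r
    rw [hq, div_pow, div_le_iff₀ (by positivity)]
    have h1 : V ^ r ≤ Δ.card ^ r * ((digitValues (gen β α) (r * n)).card : ℝ) := by
      rw [hV]
      exact_mod_cast card_digitValues_pow_le Δ hΔ n r
    have hC0 : 0 ≤ C := by
      have := hC 0
      simp at this
      exact (Nat.cast_nonneg _).trans this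
    calc V ^ r ≤ Δ.card ^ r * ((digitValues (gen β α) (r * n)).card : ℝ) := h1
      _ ≤ Δ.card ^ r * (C * ((r * n : ℕ) + 1) ^ 2 * β ^ (r * n)) := by gcongr; exact hC _
      _ ≤ Δ.card ^ r * (C * ((n + 1) * (r + 1)) ^ 2 * β ^ (r * n)) := by
        gcongr
        push_cast
        nlinarith [(Nat.cast_nonneg n : (0 : ℝ) ≤ n), (Nat.cast_nonneg r : (0 : ℝ) ≤ r)]
      _ = _ := by rw [mul_pow, mul_comm r n, pow_mul]; ring
  have hlim := tendsto_pow_const_div_const_pow_of_one_lt 2 hq1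
  have hlim' := ((hlim.comp (Filter.tendsto_add_atTop_nat 1)).const_mul (C * (n + 1) ^ 2 * q))
  rw [mul_zero] at hlim'
  obtain ⟨r, hr⟩ := (hlim'.eventually_lt_const one_pos).exists
  have := hbound r
  simp only [Function.comp] at hr
  rw [pow_succ q, ← mul_div_assoc, div_lt_one (by positivity)] at hr
  push_cast at hr
  have := mul_le_mul_of_nonneg_right this (by positivity : 0 ≤ q)
  linarith

/-- The open interval of those `t` whose orbit under the maps `t ↦ β * t + e`, `e ∈ {0, 1}`, can
stay within bounded distance of the orbit of `y` under `t ↦ β * t`. -/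
def window (β y : ℝ) : Set ℝ := Set.Ioo (y - (β - 1)⁻¹) y

theorem mem_window {β y t : ℝ} : t ∈ window β y ↔ y - (β - 1)⁻¹ < t ∧ t < y := Iff.rfl

theorem mul_inv_sub_one (h : IsSalemPair β α) : β * (β - 1)⁻¹ = (β - 1)⁻¹ + 1 := by
  have : β - 1 ≠ 0 := by linarith [h.one_lt]
  field_simp
  ring

theorem one_lt_inv_sub_one (h : IsSalemPair β α) : 1 < (β - 1)⁻¹ :=
  (one_lt_inv₀ (by linarith [h.one_lt])).2 (by linarith [h.lt_two])

open Classical in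
/-- The greedy choice of a digit keeping the first coordinate in the window of `β * y`. -/
noncomputable def trackDigit (β y t : ℝ) : Emb := if β * y - (β - 1)⁻¹ < β * t then 0 else 1

theorem trackDigit_eq_zero_or_one (β y t : ℝ) : trackDigit β y t = 0 ∨ trackDigit β y t = 1 := by
  unfold trackDigit
  split_ifs <;> simp

theorem step_trackDigit_mem_window (h : IsSalemPair β α) {x : Emb} {y : ℝ}
    (hx : x.1 ∈ window β y) : (gen β α * x + trackDigit β y x.1).1 ∈ window β (β * y) := by
  have hb := h.one_lt
  have h1 := h.mul_inv_sub_one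
  have h2 := h.one_lt_inv_sub_one
  rw [mem_window] at *
  have h3 := mul_lt_mul_of_pos_left hx.1 (by linarith : 0 < β)
  have h4 := mul_lt_mul_of_pos_left hx.2 (by linarith : 0 < β)
  rw [mul_sub] at h3
  unfold trackDigit
  split_ifs with hc
  · simpa [gen] using ⟨by linarith, h4⟩
  · simp only [gen, Prod.fst_add, Prod.fst_mul, Prod.fst_one]
    constructor <;> linarith

theorem mem_window_of_step (h : IsSalemPair β α) {x e : Emb} {y : ℝ} (he : e = 0 ∨ e = 1)
    (hx : (gen β α * x + e).1 ∈ window β (β * y)) : x.1 ∈ window β y := by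
  have hb := h.one_lt
  have h1 := h.mul_inv_sub_one
  have he' : 0 ≤ e.1 ∧ e.1 ≤ 1 := by rcases he with rfl | rfl <;> simp
  rw [mem_window] at *
  simp only [gen, Prod.fst_add, Prod.fst_mul] at hx
  constructor
  · refine lt_of_mul_lt_mul_left (a := β) ?_ (by linarith)
    rw [mul_sub]
    linarith [hx.1]
  · refine lt_of_mul_lt_mul_left (a := β) ?_ (by linarith)
    linarith [hx.2]

theorem exists_pow_mul_add_mem_window (h : IsSalemPair β α) {x : Emb} {y : ℝ}
    (hx : x.1 ∈ window β y) (m : ℕ) :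
    ∃ q ∈ digitValues (gen β α) m, (gen β α ^ m * x + q).1 ∈ window β (β ^ m * y) := by
  induction m with
  | zero => exact ⟨0, mem_digitValues_zero.2 rfl, by simpa using hx⟩
  | succ m ih =>
    obtain ⟨q, hq, hw⟩ := ih
    refine ⟨_, step_mem_digitValues hq (trackDigit_eq_zero_or_one β (β ^ m * y)
      (gen β α ^ m * x + q).1), ?_⟩
    have := h.step_trackDigit_mem_window hw
    convert this using 1
    · congr 1; ring
    · congr 1; ring

theorem gen_quintic_eq (h : IsSalemPair β α) :
    gen β α ^ 5 - gen β α ^ 4 - gen β α ^ 3 - gen β α ^ 2 = gen β α - 1 := by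
  have h2 : √2 ^ 2 = 2 := Real.sq_sqrt (by norm_num)
  have h2' : (√2 : ℂ) ^ 2 = 2 := by exact_mod_cast h2
  have key {R : Type} [CommRing R] (x s : R) (hs : s ^ 2 = 2) (hx : x ^ 2 = (1 + s) * x - 1) :
      x ^ 5 - x ^ 4 - x ^ 3 - x ^ 2 = x - 1 := by
    linear_combination (x + 1) * (x ^ 2 - (1 - s) * x + 1) * hx + (x + 1) * x ^ 2 * hs
  refine Prod.ext (key β √2 h2 h.sq_eq) (Prod.ext (key β⁻¹ √2 h2 h.inv_sq_eq)
    (key α (-√2) (by linear_combination h2') (by linear_combination h.sq_eq')))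

theorem ne_zero (h : IsSalemPair β α) : α ≠ 0 := by
  rintro rfl
  exact lt_irrefl _ h.im_pos

theorem abs_im_pow_sub_le (h : IsSalemPair β α) {j j' : ℕ} (hj : j ≤ j') :
    |(α ^ (j' - j)).im| ≤ |(α⁻¹ ^ j).im| + |(α⁻¹ ^ j').im| := by
  have hα := h.ne_zero
  have hu : ∀ i : ℕ, ‖α⁻¹ ^ i‖ = 1 := fun i => by rw [norm_pow, norm_inv, h.norm_eq]; simp
  have : α ^ (j' - j) = α⁻¹ ^ j * (starRingEnd ℂ) (α⁻¹ ^ j') := by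
    have hc : (starRingEnd ℂ) (α⁻¹ ^ j') = α ^ j' := by
      rw [← Complex.inv_eq_conj (hu j'), inv_pow, inv_inv]
    rw [hc, pow_sub₀ _ hα hj, inv_pow, mul_comm]
  rw [this, Complex.mul_im, Complex.conj_re, Complex.conj_im]
  have hr : ∀ i : ℕ, |(α⁻¹ ^ i).re| ≤ 1 := fun i => (Complex.abs_re_le_norm _).trans (hu i).le
  refine (abs_add_le _ _).trans ?_
  rw [abs_mul, abs_mul, abs_neg]
  nlinarith [hr j, hr j', abs_nonneg (α⁻¹ ^ j).im, abs_nonneg (α⁻¹ ^ j').im]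

theorem cube_sub_eq (h : IsSalemPair β α) :
    (gen β α ^ 3 - (gen β α ^ 2 + gen β α + 1)).1 = β⁻¹ - β⁻¹ ^ 2 ∧
    (gen β α ^ 3 - (gen β α ^ 2 + gen β α + 1)).2.2 = α⁻¹ - α⁻¹ ^ 2 := by
  have hb : β ≠ 0 := by linarith [h.one_lt]
  have hα := h.ne_zero
  have h1 := congrArg Prod.fst h.gen_quintic_eq
  have h2 := congrArg (fun x => x.2.2) h.gen_quintic_eq
  simp [gen] at h1 h2 ⊢
  constructor
  · field_simp
    linear_combination h1
  · field_simp
    linear_combination h2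

open Classical in
/-- The digit `r` for which `(e - r) * Im (α⁻¹ ^ n)` is nonnegative for both digits `e`. -/
noncomputable def signDigit (α : ℂ) (n : ℕ) : Emb :=
  if 0 < (α⁻¹ ^ n).im then 0 else 1

theorem signDigit_eq_zero_or_one (α : ℂ) (n : ℕ) : signDigit α n = 0 ∨ signDigit α n = 1 := by
  unfold signDigit
  split_ifs <;> simp

theorem im_sub_signDigit (α : ℂ) (n : ℕ) {e : Emb} (he : e = 0 ∨ e = 1) :
    0 ≤ (α⁻¹ ^ n * (e - signDigit α n).2.2).im ∧
    (e ≠ signDigit α n → (α⁻¹ ^ n * (e - signDigit α n).2.2).im = |(α⁻¹ ^ n).im|) := by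
  unfold signDigit
  generalize α⁻¹ ^ n = z
  split_ifs with hc <;> rcases he with rfl | rfl
  · simp
  · simp [abs_of_pos hc, hc.le]
  · push Not at hc
    simp [abs_of_nonpos hc, hc]
  · simp

theorem exists_abs_fst_lower_bound (Δ : Finset Emb) :
    ∃ δ > 0, ∀ D ∈ Δ, D.1 ≠ 0 → δ ≤ |D.1| := by
  induction Δ using Finset.induction_on with
  | empty => exact ⟨1, one_pos, by simp⟩
  | insert a s _ ih =>
    obtain ⟨δ, hδ, hs⟩ := ih
    by_cases ha : a.1 = 0
    · exact ⟨δ, hδ, by simpa [ha] using hs⟩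
    · refine ⟨min δ |a.1|, lt_min hδ (abs_pos.2 ha), ?_⟩
      intro D hD hD0
      rcases Finset.mem_insert.1 hD with rfl | hD
      · exact min_le_right _ _
      · exact (min_le_left _ _).trans (hs D hD hD0)

theorem exists_im_pow_lower_bound (h : IsSalemPair β α) (R : ℕ) :
    ∃ η > 0, ∀ r, r ≠ 0 → r ≤ R → η ≤ |(α ^ r).im| := by
  induction R with
  | zero => exact ⟨1, one_pos, fun r hr hr' => absurd (Nat.le_zero.1 hr') hr⟩
  | succ R ih =>
    obtain ⟨η, hη, hs⟩ := ih
    refine ⟨min η |(α ^ (R + 1)).im|, lt_min hη (abs_pos.2 (h.im_pow_ne_zero (by lia))), ?_⟩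
    intro r hr hr'
    rcases Nat.lt_or_eq_of_le hr' with hlt | rfl
    · exact (min_le_left _ _).trans (hs r hr (by lia))
    · exact min_le_right _ _

theorem mul_lt_norm_sub (h : IsSalemPair β α) (Δ : Finset Emb) (N : ℕ)
    {U B : ℕ → Emb} {e : ℕ → Emb} (he : ∀ n, e n = 0 ∨ e n = 1)
    (hU : ∀ n, U (n + 1) = gen β α * U n + e n)
    (hB : ∀ n, B (n + 1) = gen β α * B n + signDigit α n)
    (h0 : 0 < (α * (U 0 - B 0).2.2).im)
    (hlat : ∀ n, U n - B n ∈ lattice β α)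
    (hΔ : ∀ n ≤ N, U n - B n ∈ Δ)
    (hL : ∀ n ≤ N, |(U n - B n).1| < (β - 1)⁻¹)
    {δ : ℝ} (hδ : ∀ D ∈ Δ, D.1 ≠ 0 → δ ≤ |D.1|)
    {R : ℕ} (hR : (β - 1)⁻¹ < δ * β ^ R) {η : ℝ}
    (hη : ∀ r, r ≠ 0 → r ≤ 2 * R → η ≤ |(α ^ r).im|) (k : ℕ) (hk : 2 * R * k ≤ N) :
    k * η < ‖(U (2 * R * k) - B (2 * R * k)).2.2‖ := by
  have hb := h.one_lt
  have hα := h.ne_zero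
  set σ : ℕ → ℝ := fun n => (α * α⁻¹ ^ n * (U n - B n).2.2).im with hσ
  have hσ0 : 0 < σ 0 := by simpa [hσ] using h0
  have hD : ∀ n, U (n + 1) - B (n + 1) = gen β α * (U n - B n) + (e n - signDigit α n) := by
    intro n; rw [hU, hB]; ring
  have hσs : ∀ n, σ (n + 1) = σ n + (α⁻¹ ^ n * (e n - signDigit α n).2.2).im := by
    intro n
    simp only [hσ]
    rw [hD, ← Complex.add_im]
    congr 1
    simp only [gen, Prod.snd_add, Prod.snd_mul]
    rw [pow_succ]
    field_simp
  have hmono : Monotone σ := monotone_nat_of_le_succ fun n => by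
    rw [hσs]; linarith [(im_sub_signDigit α n (he n)).1]
  have hjump : ∀ n, e n ≠ signDigit α n → σ (n + 1) = σ n + |(α⁻¹ ^ n).im| := fun n hn => by
    rw [hσs, (im_sub_signDigit α n (he n)).2 hn]
  have hne : ∀ n, (U n - B n).1 ≠ 0 := by
    intro n hn
    have := h.eq_zero_of_fst_eq_zero (hlat n) hn
    have h1 := hσ0.trans_le (hmono (Nat.zero_le n))
    simp only [hσ] at h1
    rw [this] at h1
    simp at h1
  have hexists : ∀ n, n + R ≤ N → ∃ j, n ≤ j ∧ j < n + R ∧ e j ≠ signDigit α j := by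
    intro n hn
    by_contra! hc
    have hgrow : ∀ i ≤ R, (U (n + i) - B (n + i)).1 = β ^ i * (U n - B n).1 := by
      intro i hi
      induction i with
      | zero => simp
      | succ i ih =>
        rw [← add_assoc, hD, hc (n + i) (by lia) (by lia), sub_self, add_zero, Prod.fst_mul,
          ih (by lia), pow_succ]
        simp only [gen]
        ring
    have h1 := hL (n + R) hn
    rw [hgrow R le_rfl, abs_mul, abs_of_pos (by positivity)] at h1
    have h2 := hδ _ (hΔ n (by lia)) (hne n)
    have h3 : δ * β ^ R ≤ |(U n - B n).1| * β ^ R := by gcongr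
    linarith
  have hstep : ∀ n, n + 2 * R ≤ N → σ n + η ≤ σ (n + 2 * R) := by
    intro n hn
    obtain ⟨j, hj1, hj2, hj⟩ := hexists n (by lia)
    obtain ⟨j', hj1', hj2', hj'⟩ := hexists (n + R) (by lia)
    have g1 := hjump j hj
    have g2 := hjump j' hj'
    have g3 : σ n ≤ σ j := hmono hj1
    have g4 : σ (j + 1) ≤ σ j' := hmono (by lia)
    have g5 : σ (j' + 1) ≤ σ (n + 2 * R) := hmono (by lia)
    have g6 := h.abs_im_pow_sub_le (by lia : j ≤ j')
    have g7 := hη (j' - j) (by lia) (by lia)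
    linarith
  have hσk : k * η < σ (2 * R * k) := by
    induction k with
    | zero => simpa using hσ0
    | succ k ih =>
      have h1 : 2 * R * (k + 1) = 2 * R * k + 2 * R := by ring
      rw [h1] at hk ⊢
      have := hstep _ hk
      push_cast
      linarith [ih (by lia)]
  refine hσk.trans_le ((le_abs_self _).trans ((Complex.abs_im_le_norm _).trans ?_))
  rw [norm_mul, norm_mul, norm_pow, norm_inv, h.norm_eq]
  simp

theorem exists_sub_not_mem (h : IsSalemPair β α) (Δ : Finset Emb) :
    ∃ ℓ, ∃ x ∈ digitValues (gen β α) ℓ, ∃ x' ∈ digitValues (gen β α) ℓ, ∃ y,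
      x.1 ∈ window β y ∧ x'.1 ∈ window β y ∧ x - x' ∉ Δ := by
  by_contra! H
  have hb := h.one_lt
  have hb0 : 0 < β := by linarith
  have hL0 : 0 < (β - 1)⁻¹ := by linarith [h.one_lt_inv_sub_one]
  obtain ⟨δ, hδ0, hδ⟩ := exists_abs_fst_lower_bound Δ
  obtain ⟨R, hR⟩ := pow_unbounded_of_one_lt ((β - 1)⁻¹ / δ) hb
  rw [div_lt_iff₀' hδ0] at hR
  obtain ⟨η, hη0, hη⟩ := h.exists_im_pow_lower_bound (2 * R)
  obtain ⟨K, hK⟩ : ∃ K : ℝ, ∀ D ∈ Δ, ‖D.2.2‖ ≤ K := by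
    obtain ⟨K, hK⟩ := (Δ.image fun D => ‖D.2.2‖).bddAbove
    exact ⟨K, fun D hD => hK (by simpa using ⟨_, _, _, hD, rfl⟩)⟩
  obtain ⟨k, hk⟩ := exists_nat_gt (K / η)
  rw [div_lt_iff₀ hη0] at hk
  set N := 2 * R * k + 1 with hN
  let B : ℕ → Emb := fun n => n.rec (gen β α ^ 2 + gen β α + 1)
    fun n x => gen β α * x + signDigit α n
  have hB0 : B 0 = gen β α ^ 2 + gen β α + 1 := rfl
  have hB : ∀ n, B (n + 1) = gen β α * B n + signDigit α n := fun n => rfl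
  clear_value B
  set Y := ((B N).1 + (β - 1)⁻¹ / 2) / β ^ N with hY
  have hBw : ∀ n ≤ N, (B n).1 ∈ window β (β ^ n * Y) := by
    intro n hn
    induction hn using Nat.decreasingInduction with
    | of_succ n _ ih =>
      rw [hB, pow_succ', mul_assoc] at ih
      exact h.mem_window_of_step (signDigit_eq_zero_or_one α n) ih
    | self =>
      rw [hY, mul_div_cancel₀ _ (by positivity), mem_window]
      constructor <;> linarith
  have hB1 : β * (B 0).1 + 1 < β * Y := by
    have := (hBw 1 (by lia)).2
    rw [hB 0] at this
    simpa [signDigit, gen] using this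
  let U : ℕ → Emb := fun n => n.rec (gen β α ^ 3)
    fun n x => gen β α * x + trackDigit β (β ^ n * Y) x.1
  have hU0 : U 0 = gen β α ^ 3 := rfl
  have hU : ∀ n, U (n + 1) = gen β α * U n + trackDigit β (β ^ n * Y) (U n).1 := fun n => rfl
  clear_value U
  have hUw : ∀ n, (U n).1 ∈ window β (β ^ n * Y) := by
    intro n
    induction n with
    | zero =>
      have h1 := h.cube_sub_eq.1
      rw [← hU0, ← hB0, Prod.fst_sub] at h1
      have h2 := (hBw 0 (Nat.zero_le _)).1
      have hi : β * β⁻¹ = 1 := mul_inv_cancel₀ hb0.ne'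
      have hi0 : 0 < β⁻¹ := by positivity
      have hi1 : β⁻¹ < 1 := inv_lt_one_of_one_lt₀ hb
      rw [pow_zero, one_mul] at h2 ⊢
      refine ⟨by nlinarith, ?_⟩
      refine lt_of_mul_lt_mul_left (a := β) ?_ hb0.le
      nlinarith
    | succ n ih =>
      rw [hU, pow_succ', mul_assoc]
      exact h.step_trackDigit_mem_window ih
  have hmem : ∀ n, U n ∈ digitValues (gen β α) (4 + n) ∧ B n ∈ digitValues (gen β α) (4 + n) := by
    intro n
    induction n with
    | zero =>
      have z : (0 : Emb) ∈ digitValues (gen β α) 0 := mem_digitValues_zero.2 rfl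
      have u := step_mem_digitValues (step_mem_digitValues (step_mem_digitValues
        (step_mem_digitValues z (.inr rfl)) (.inl rfl)) (.inl rfl)) (.inl rfl)
      have b := step_mem_digitValues (step_mem_digitValues (step_mem_digitValues
        (step_mem_digitValues z (.inl rfl)) (.inr rfl)) (.inr rfl)) (.inr rfl)
      rw [hU0, hB0]
      constructor
      · convert u using 1; ring
      · convert b using 1; ring
    | succ n ih =>
      rw [hU, hB]
      exact ⟨step_mem_digitValues ih.1 (trackDigit_eq_zero_or_one _ _ _),
        step_mem_digitValues ih.2 (signDigit_eq_zero_or_one _ _)⟩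
  have hΔ : ∀ n ≤ N, U n - B n ∈ Δ := fun n hn =>
    H _ _ (hmem n).1 _ (hmem n).2 _ (hUw n) (hBw n hn)
  have hgrow := h.mul_lt_norm_sub Δ N (fun n => trackDigit_eq_zero_or_one _ _ _) hU hB
    (by
      rw [hU0, hB0, h.cube_sub_eq.2]
      have hα := h.ne_zero
      have : α * (α⁻¹ - α⁻¹ ^ 2) = 1 - α⁻¹ := by field_simp
      rw [this, Complex.inv_eq_conj h.norm_eq]
      simpa using h.im_pos)
    (fun n => sub_mem (h.mem_lattice_of_mem_digitValues (hmem n).1)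
      (h.mem_lattice_of_mem_digitValues (hmem n).2)) hΔ
    (fun n hn => by
      have h1 := hUw n
      have h2 := hBw n hn
      rw [mem_window] at h1 h2
      rw [Prod.fst_sub, abs_lt]
      constructor <;> linarith) hδ hR hη k (by lia)
  have := hK _ (hΔ (2 * R * k) (by lia))
  linarith

open Filter Topology MeasureTheory

theorem eventually_mem_window {β t y : ℝ} (ht : t ∈ window β y) :
    ∀ᶠ y' in 𝓝 y, t ∈ window β y' := by
  rw [mem_window] at ht
  filter_upwards [Iio_mem_nhds (by linarith [ht.1] : y < t + (β - 1)⁻¹), Ioi_mem_nhds ht.2]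
    with y' h1 h2
  exact ⟨by linarith [Set.mem_Iio.1 h1], h2⟩

theorem exists_noncolliding (h : IsSalemPair β α) (Δ : Finset Emb)
    (hΔ : ∀ n, ∀ x ∈ digitValues (gen β α) n, ∀ x' ∈ digitValues (gen β α) n,
      Collide (gen β α) x x' → x - x' ∈ Δ) (k : ℕ) :
    ∃ (n : ℕ) (y : ℝ) (s : Finset Emb), s ⊆ digitValues (gen β α) n ∧ s.card = k + 1 ∧
      (∀ x ∈ s, x.1 ∈ window β y) ∧
      ∀ x ∈ s, ∀ x' ∈ s, x ≠ x' → ¬ Collide (gen β α) x x' := by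
  classical
  have hb := h.one_lt
  have hL0 : 0 < (β - 1)⁻¹ := by linarith [h.one_lt_inv_sub_one]
  induction k with
  | zero =>
    refine ⟨0, (β - 1)⁻¹ / 2, {0}, ?_, rfl, ?_, ?_⟩
    · simp [digitValues]
    · intro x hx
      rw [Finset.mem_singleton.1 hx, mem_window]
      simp only [Prod.fst_zero]
      constructor <;> linarith
    · intro x hx x' hx' hne
      exact absurd ((Finset.mem_singleton.1 hx).trans (Finset.mem_singleton.1 hx').symm) hne
  | succ k ih =>
    obtain ⟨n, y, s, hsV, hcard, hw, hnc⟩ := ih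
    obtain ⟨ℓ, x, hx, x', hx', y₀, hxw, hxw', hxx⟩ := h.exists_sub_not_mem Δ
    replace hxx : ¬ Collide (gen β α) x x' := fun hc => hxx (hΔ ℓ x hx x' hx' hc)
    obtain ⟨x₀, hx₀⟩ : s.Nonempty := Finset.card_pos.1 (by lia)
    have hev : ∀ᶠ y' in 𝓝 y, ∀ z ∈ s, z.1 ∈ window β y' :=
      (Filter.eventually_all_finset s).2 fun z hz => eventually_mem_window (hw z hz)
    obtain ⟨ε, hε, hball⟩ := Metric.eventually_nhds_iff.1 hev
    obtain ⟨n₀, hn₀⟩ := pow_unbounded_of_one_lt (((β - 1)⁻¹ + |y₀|) / ε) hb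
    obtain ⟨q, hq, hqw⟩ := h.exists_pow_mul_add_mem_window (hw x₀ hx₀) n₀
    set X := gen β α ^ n₀ * x₀ + q with hX
    set y' := β ^ ℓ * X.1 + y₀ with hy'
    have hpos : ∀ i : ℕ, 0 < β ^ i := fun i => by positivity
    have hclose : dist (y' / β ^ (n₀ + ℓ)) y < ε := by
      rw [Real.dist_eq, show y' / β ^ (n₀ + ℓ) - y =
        ((X.1 - β ^ n₀ * y) + y₀ / β ^ ℓ) / β ^ n₀ by
          rw [hy', pow_add]; field_simp; ring, abs_div, abs_of_pos (hpos n₀),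
        div_lt_iff₀ (hpos n₀)]
      rw [div_lt_iff₀' hε] at hn₀
      refine lt_of_le_of_lt ((abs_add_le _ _).trans (add_le_add ?_ ?_)) hn₀
      · rw [mem_window] at hqw
        rw [abs_le]
        constructor <;> linarith
      · rw [abs_div, abs_of_pos (hpos ℓ)]
        exact div_le_self (abs_nonneg _) (one_le_pow₀ hb.le)
    have hwin : ∀ {z : Emb}, z.1 ∈ window β y₀ → (gen β α ^ ℓ * X + z).1 ∈ window β y' := by
      intro z hz
      rw [mem_window] at hz ⊢
      simp only [gen, Prod.fst_add, Prod.fst_mul, Prod.pow_fst]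
      constructor <;> linarith
    have htrack : ∀ z ∈ s, ∃ g ∈ digitValues (gen β α) (n₀ + ℓ),
        (gen β α ^ (n₀ + ℓ) * z + g).1 ∈ window β y' ∧
        (z = x₀ → g = gen β α ^ ℓ * q + x) := by
      intro z hz
      by_cases hzx : z = x₀
      · refine ⟨_, pow_mul_add_mem_digitValues hq hx, ?_, fun _ => rfl⟩
        convert hwin hxw using 2
        rw [hzx, hX]; ring
      · obtain ⟨g, hg, hgw⟩ := h.exists_pow_mul_add_mem_window (hball hclose z hz) (n₀ + ℓ)
        rw [mul_div_cancel₀ _ (hpos _).ne'] at hgw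
        exact ⟨g, hg, hgw, fun hz' => absurd hz' hzx⟩
    choose! g hgV hgw hgx using htrack
    have hnew : ∀ z ∈ s, ¬ Collide (gen β α) (gen β α ^ (n₀ + ℓ) * x₀ + (gen β α ^ ℓ * q + x'))
        (gen β α ^ (n₀ + ℓ) * z + g z) := by
      intro z hz hc
      by_cases hzx : z = x₀
      · rw [hgx z hz hzx, hzx, ← add_assoc, ← add_assoc] at hc
        exact hxx hc.of_add_left.symm
      · exact hnc x₀ hx₀ z hz (Ne.symm hzx)
          (hc.of_pow_mul_add (pow_mul_add_mem_digitValues hq hx') (hgV z hz))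
    have hinj : ∀ z ∈ s, ∀ z' ∈ s, z ≠ z' → ¬ Collide (gen β α)
        (gen β α ^ (n₀ + ℓ) * z + g z) (gen β α ^ (n₀ + ℓ) * z' + g z') :=
      fun z hz z' hz' hne hc => hnc z hz z' hz' hne (hc.of_pow_mul_add (hgV z hz) (hgV z' hz'))
    refine ⟨n + (n₀ + ℓ), y', insert (gen β α ^ (n₀ + ℓ) * x₀ + (gen β α ^ ℓ * q + x'))
      (s.image fun z => gen β α ^ (n₀ + ℓ) * z + g z), ?_, ?_, ?_, ?_⟩
    · intro z hz
      rcases Finset.mem_insert.1 hz with rfl | hz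
      · exact pow_mul_add_mem_digitValues (hsV hx₀) (pow_mul_add_mem_digitValues hq hx')
      · obtain ⟨v, hv, rfl⟩ := Finset.mem_image.1 hz
        exact pow_mul_add_mem_digitValues (hsV hv) (hgV v hv)
    · rw [Finset.card_insert_of_notMem, Finset.card_image_of_injOn, hcard]
      · intro z hz z' hz' hzz
        by_contra hne
        refine hinj z hz z' hz' hne ?_
        simp only at hzz
        rw [hzz]
        exact Collide.refl _ _
      · intro hmem
        obtain ⟨z, hz, hzz⟩ := Finset.mem_image.1 hmem
        refine hnew z hz ?_
        rw [hzz]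
        exact Collide.refl _ _
    · intro z hz
      rcases Finset.mem_insert.1 hz with rfl | hz
      · convert hwin hxw' using 2
        rw [hX]; ring
      · obtain ⟨v, hv, rfl⟩ := Finset.mem_image.1 hz
        exact hgw v hv
    · intro z hz z' hz' hne
      rcases Finset.mem_insert.1 hz with rfl | hz <;> rcases Finset.mem_insert.1 hz' with rfl | hz'
      · exact absurd rfl hne
      · obtain ⟨v', hv', rfl⟩ := Finset.mem_image.1 hz'
        exact hnew v' hv'
      · obtain ⟨v, hv, rfl⟩ := Finset.mem_image.1 hz
        exact fun hc => hnew v hv hc.symm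
      · obtain ⟨v, hv, rfl⟩ := Finset.mem_image.1 hz
        obtain ⟨v', hv', rfl⟩ := Finset.mem_image.1 hz'
        exact hinj v hv v' hv' fun hzz => hne (by rw [hzz])

/-- A measurable set of reals is null if, at arbitrarily small scales, it misses a fixed proportion
of a ball around a point near each of its elements. -/
theorem volume_eq_zero_of_disjoint_balls (S : Set ℝ) {R ε : ℝ} (hε : 0 < ε) (hεR : ε ≤ R)
    {ρ : ℕ → ℝ} (hρ : Tendsto ρ atTop (𝓝[>] 0))
    (hS : ∀ t ∈ S, ∀ m, ∃ c, |t - c| ≤ R * ρ m ∧ Disjoint S (Metric.ball c (ε * ρ m)))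
    (hSm : MeasurableSet S) : volume S = 0 := by
  have hR : 0 < R := hε.trans_le hεR
  rw [← Measure.restrict_eq_zero, ← ae_eq_bot]
  by_contra hbot
  have : (ae (volume.restrict S)).NeBot := ⟨hbot⟩
  obtain ⟨t, htS, ht⟩ := ((ae_restrict_mem hSm).and
    (IsUnifLocDoublingMeasure.ae_tendsto_measure_inter_div volume S 1)).exists
  choose c hc hdis using hS t htS
  have hlim := @ht ℕ atTop c (fun m => R * ρ m) (by
    rw [tendsto_nhdsWithin_iff] at hρ ⊢
    refine ⟨by simpa using hρ.1.const_mul R, ?_⟩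
    filter_upwards [hρ.2] with m hm
    exact mul_pos hR hm) (Eventually.of_forall fun m => by
      rw [one_mul, Metric.mem_closedBall, Real.dist_eq]; exact hc m)
  have hbound : ∀ᶠ m in atTop, volume (S ∩ Metric.closedBall (c m) (R * ρ m)) /
      volume (Metric.closedBall (c m) (R * ρ m)) ≤ ENNReal.ofReal ((R - ε) / R) := by
    filter_upwards [(tendsto_nhdsWithin_iff.1 hρ).2] with m hm
    have hm : 0 < ρ m := hm
    rw [Real.volume_closedBall]
    have hsub : S ∩ Metric.closedBall (c m) (R * ρ m) ⊆
        Metric.closedBall (c m) (R * ρ m) \ Metric.ball (c m) (ε * ρ m) :=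
      fun z hz => ⟨hz.2, Set.disjoint_left.1 (hdis m) hz.1⟩
    have hle : Metric.ball (c m) (ε * ρ m) ⊆ Metric.closedBall (c m) (R * ρ m) :=
      Metric.ball_subset_closedBall.trans (Metric.closedBall_subset_closedBall (by gcongr))
    have hvol : volume (Metric.closedBall (c m) (R * ρ m) \ Metric.ball (c m) (ε * ρ m)) =
        ENNReal.ofReal (2 * (R * ρ m) - 2 * (ε * ρ m)) := by
      rw [measure_sdiff hle measurableSet_ball.nullMeasurableSet measure_ball_lt_top.ne,
        Real.volume_closedBall, Real.volume_ball, ENNReal.ofReal_sub _ (by positivity)]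
    refine ENNReal.div_le_of_le_mul ?_
    refine (measure_mono hsub).trans (hvol.le.trans ?_)
    rw [← ENNReal.ofReal_mul (div_nonneg (by linarith) hR.le)]
    refine ENNReal.ofReal_le_ofReal (le_of_eq ?_)
    field_simp
  have := le_of_tendsto hlim hbound
  rw [← ENNReal.ofReal_one, ENNReal.ofReal_le_ofReal_iff (div_nonneg (by linarith) hR.le),
    le_div_iff₀ hR] at this
  linarith

theorem false_of_forall_collide (h : IsSalemPair β α) (Δ : Finset Emb)
    (hΔ : ∀ n, ∀ x ∈ digitValues (gen β α) n, ∀ x' ∈ digitValues (gen β α) n,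
      Collide (gen β α) x x' → x - x' ∈ Δ) : False := by
  classical
  have hb := h.one_lt
  have hpos : ∀ i : ℕ, 0 < β ^ i := fun i => by positivity
  set L := (β - 1)⁻¹ with hL
  have hL0 : 0 < L := by linarith [h.one_lt_inv_sub_one]
  obtain ⟨ℓ, y, s, hsV, hcard, hw, hnc⟩ := h.exists_noncolliding Δ hΔ Δ.card
  obtain ⟨ε, hε, hball⟩ := Metric.eventually_nhds_iff.1
    ((Filter.eventually_all_finset s).2 fun z hz => eventually_mem_window (hw z hz))
  let G : ℕ → Set ℝ := fun m => ⋃ v ∈ digitValues (gen β α) m,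
    Metric.ball (v.1 / β ^ m + y / β ^ (m + ℓ)) (ε / β ^ (m + ℓ))
  have hGm : ∀ m, MeasurableSet (G m) := fun m =>
    Finset.measurableSet_biUnion _ fun v _ => measurableSet_ball
  have hG : ∀ m n, m + ℓ ≤ n → ∀ t ∈ G m, ∃ u ⊆ digitValues (gen β α) n, u.card = Δ.card + 1 ∧
      ∀ x ∈ u, x.1 ∈ window β (β ^ n * t) := by
    intro m n hmn t ht
    simp only [G, Set.mem_iUnion] at ht
    obtain ⟨v, hv, ht⟩ := ht
    obtain ⟨i, rfl⟩ := Nat.exists_eq_add_of_le hmn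
    have htw : ∀ z ∈ s, (gen β α ^ ℓ * v + z).1 ∈ window β (β ^ (m + ℓ) * t) := by
      intro z hz
      have hd : dist (β ^ (m + ℓ) * t - β ^ ℓ * v.1) y < ε := by
        rw [Metric.mem_ball, Real.dist_eq, lt_div_iff₀ (hpos _)] at ht
        rw [Real.dist_eq]
        rwa [show β ^ (m + ℓ) * t - β ^ ℓ * v.1 - y =
          (t - (v.1 / β ^ m + y / β ^ (m + ℓ))) * β ^ (m + ℓ) by
            rw [pow_add]; field_simp; ring, abs_mul, abs_of_pos (hpos _)]
      have := hball hd z hz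
      rw [mem_window] at this ⊢
      simp only [gen, Prod.fst_add, Prod.fst_mul, Prod.pow_fst]
      constructor <;> linarith
    have hex : ∀ z ∈ s, ∃ q ∈ digitValues (gen β α) i,
        (gen β α ^ i * (gen β α ^ ℓ * v + z) + q).1 ∈ window β (β ^ (m + ℓ + i) * t) := by
      intro z hz
      obtain ⟨q, hq, hqw⟩ := h.exists_pow_mul_add_mem_window (htw z hz) i
      refine ⟨q, hq, ?_⟩
      rwa [← mul_assoc, ← pow_add, add_comm i] at hqw
    choose! q hqV hqw using hex
    refine ⟨s.image fun z => gen β α ^ i * (gen β α ^ ℓ * v + z) + q z, ?_, ?_, ?_⟩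
    · intro x hx
      obtain ⟨z, hz, rfl⟩ := Finset.mem_image.1 hx
      exact pow_mul_add_mem_digitValues (pow_mul_add_mem_digitValues hv (hsV hz)) (hqV z hz)
    · rw [Finset.card_image_of_injOn, hcard]
      intro z hz z' hz' hzz
      by_contra hne
      refine hnc z hz z' hz' hne
        (Collide.of_add_left (a := gen β α ^ ℓ * v) (Collide.of_pow_mul_add (hqV z hz)
          (hqV z' hz') ?_))
      simp only at hzz
      rw [hzz]
      exact Collide.refl _ _
    · intro x hx
      obtain ⟨z, hz, rfl⟩ := Finset.mem_image.1 hx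
      exact hqw z hz
  have hnull : volume (Set.Ioo 0 L \ ⋃ m, G m) = 0 := by
    have hℓ := hpos ℓ
    refine volume_eq_zero_of_disjoint_balls _ (R := L + |y| + ε) (ε := ε / β ^ ℓ)
      (ρ := fun m => (β⁻¹) ^ m) (by positivity) ?_ ?_ ?_
      (measurableSet_Ioo.diff (MeasurableSet.iUnion hGm))
    · have := div_le_self hε.le (one_le_pow₀ hb.le : 1 ≤ β ^ ℓ)
      have := abs_nonneg y
      linarith
    · exact tendsto_nhdsWithin_iff.2 ⟨tendsto_pow_atTop_nhds_zero_of_lt_one (by positivity)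
        (inv_lt_one_of_one_lt₀ hb), Eventually.of_forall fun m => by
          show 0 < β⁻¹ ^ m
          positivity⟩
    · intro t ht m
      obtain ⟨v, hv, hvw⟩ := h.exists_pow_mul_add_mem_window (x := 0) (y := t)
        (by rw [mem_window, ← hL]; exact ⟨by simpa using ht.1.2, ht.1.1⟩) m
      rw [mul_zero, zero_add, mem_window, ← hL] at hvw
      refine ⟨v.1 / β ^ m + y / β ^ (m + ℓ), ?_, ?_⟩
      · have hm := hpos m
        rw [inv_pow, ← div_eq_mul_inv, le_div_iff₀ hm]
        nth_rewrite 2 [← abs_of_pos hm]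
        rw [← abs_mul, show (t - (v.1 / β ^ m + y / β ^ (m + ℓ))) * β ^ m =
          (β ^ m * t - v.1) - y / β ^ ℓ by rw [pow_add]; field_simp; ring]
        refine (abs_sub _ _).trans ?_
        have h1 : |β ^ m * t - v.1| ≤ L := abs_le.2 ⟨by linarith, by linarith⟩
        have h2 : |y / β ^ ℓ| ≤ |y| := by
          rw [abs_div, abs_of_pos hℓ]
          exact div_le_self (abs_nonneg _) (one_le_pow₀ hb.le)
        linarith
      · rw [show ε / β ^ ℓ * β⁻¹ ^ m = ε / β ^ (m + ℓ) by rw [pow_add, inv_pow]; field_simp]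
        refine Set.disjoint_left.2 fun z hz hz' => hz.2 (Set.mem_iUnion.2 ⟨m, ?_⟩)
        exact Set.mem_biUnion hv hz'
  have hmeas : ∀ M, (Δ.card + 1 : ℕ) * volume (Set.Ioo 0 L ∩ Set.accumulate G M) ≤
      ENNReal.ofReal (Δ.card * L) := by
    intro M
    set n := M + ℓ with hn
    have hWeq : ∀ v : Emb, {t | v.1 ∈ window β (β ^ n * t)} =
        Set.Ioo (v.1 / β ^ n) ((v.1 + L) / β ^ n) := by
      intro v
      ext t
      rw [Set.mem_ofPred_eq, mem_window, Set.mem_Ioo, div_lt_iff₀' (hpos n), lt_div_iff₀' (hpos n),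
        ← hL]
      constructor <;> rintro ⟨h1, h2⟩ <;> constructor <;> linarith
    refine (natCast_mul_measure_le_card_mul volume (digitValues (gen β α) n)
      (fun v => {t | v.1 ∈ window β (β ^ n * t)}) (fun v _ => ?_)
      (c := ENNReal.ofReal (L / β ^ n)) (fun v _ => ?_) _ _ ?_).trans ?_
    · rw [hWeq]; exact measurableSet_Ioo
    · rw [hWeq, Real.volume_Ioo, add_div, add_sub_cancel_left]
    · rintro t ⟨-, ht⟩
      obtain ⟨m, hm, ht⟩ := Set.mem_accumulate.1 ht
      exact hG m n (by lia) t ht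
    · rw [← ENNReal.ofReal_natCast, ← ENNReal.ofReal_mul (Nat.cast_nonneg _)]
      refine ENNReal.ofReal_le_ofReal ?_
      rw [← mul_div_assoc, div_le_iff₀ (hpos n)]
      have := mul_le_mul_of_nonneg_right (h.card_digitValues_le Δ hΔ n) hL0.le
      linarith
  have hlim : Tendsto (fun M => volume (Set.Ioo 0 L ∩ Set.accumulate G M)) atTop
      (𝓝 (volume (Set.Ioo 0 L))) := by
    have h1 := tendsto_measure_iUnion_atTop (μ := volume)
      (s := fun M => Set.Ioo 0 L ∩ Set.accumulate G M)
      (fun M M' hM => Set.inter_subset_inter_right _ (Set.monotone_accumulate hM))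
    rw [← Set.inter_iUnion, Set.iUnion_accumulate] at h1
    have h2 := measure_inter_add_sdiff (μ := volume) (Set.Ioo 0 L) (MeasurableSet.iUnion hGm)
    rw [hnull, add_zero] at h2
    rwa [h2] at h1
  have hfinal := le_of_tendsto' (ENNReal.Tendsto.const_mul (a := ((Δ.card + 1 : ℕ) : ENNReal)) hlim
    (.inr (ENNReal.natCast_ne_top _))) hmeas
  rw [Real.volume_Ioo, sub_zero, ← ENNReal.ofReal_natCast,
    ← ENNReal.ofReal_mul (Nat.cast_nonneg _), ENNReal.ofReal_le_ofReal_iff (by positivity)] at hfinal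
  push_cast at hfinal
  linarith

end IsSalemPair

section RelLang

variable {k : Type*} [Field k] {β : k} {A : Finset k}

theorem betaEval_append (β : k) (w s : List k) :
    betaEval β (w ++ s) = β ^ s.length * betaEval β w + betaEval β s := by
  induction s using List.reverseRecOn with
  | nil => simp [betaEval]
  | append_singleton s a ih =>
    have hstep (v : List k) : betaEval β (v ++ [a]) = β * betaEval β v + a := by
      simp [betaEval]
    rw [← List.append_assoc, hstep, hstep, ih, List.length_append, List.length_singleton]
    ring

/-- The difference of the values of the two components of a word over `A × A`. -/
def wordDiff (β : k) (w : List (A × A)) : k :=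
  betaEval β (w.map fun p => (p.1 : k)) - betaEval β (w.map fun p => (p.2 : k))

theorem wordDiff_append (β : k) (w s : List (A × A)) :
    wordDiff β (w ++ s) = β ^ s.length * wordDiff β w + wordDiff β s := by
  simp only [wordDiff, List.map_append, betaEval_append, List.length_map]
  ring

theorem mem_relLang_iff {w : List (A × A)} : w ∈ relLang β A ↔ wordDiff β w = 0 :=
  sub_eq_zero.symm

open Classical in
theorem finite_wordDiff_of_isRegular (hβ : β ≠ 0) (hreg : (relLang β A).IsRegular) :
    {d | ∃ w s : List (A × A), w ++ s ∈ relLang β A ∧ wordDiff β w = d}.Finite := by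
  let f (Q : Language (A × A)) : k :=
    if hQ : ∃ s, s ∈ Q then -wordDiff β hQ.choose / β ^ hQ.choose.length else 0
  refine (hreg.finite_range_leftQuotient.image f).subset ?_
  rintro _ ⟨w, s, hs, rfl⟩
  refine ⟨_, ⟨w, rfl⟩, ?_⟩
  have hQ : ∃ s, s ∈ (relLang β A).leftQuotient w := ⟨s, hs⟩
  have hmem : w ++ hQ.choose ∈ relLang β A := hQ.choose_spec
  rw [mem_relLang_iff, wordDiff_append] at hmem
  simp only [f, dif_pos hQ]
  rw [div_eq_iff (pow_ne_zero _ hβ)]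
  linear_combination -hmem

end RelLang

namespace IsSalemPair

variable {β : ℝ} {α : ℂ} {A : Finset ℂ}

theorem exists_wordDiff_eq {a a' : ℂ} (ha : a ∈ A) (ha' : a' ∈ A) {n : ℕ} {p q : Emb}
    (hp : p ∈ digitValues (gen β α) n) (hq : q ∈ digitValues (gen β α) n) :
    ∃ s : List (A × A), s.length = n ∧ wordDiff (β : ℂ) s = (a' - a) * (p.1 - q.1 : ℝ) := by
  induction n generalizing p q with
  | zero =>
    rw [mem_digitValues_zero.1 hp, mem_digitValues_zero.1 hq]
    exact ⟨[], rfl, by simp [wordDiff]⟩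
  | succ n ih =>
    obtain ⟨p', hp', e, he, rfl⟩ := mem_digitValues_succ.1 hp
    obtain ⟨q', hq', f, hf, rfl⟩ := mem_digitValues_succ.1 hq
    obtain ⟨s, hs, hd⟩ := ih hp' hq'
    have digit {e : Emb} (he : e = 0 ∨ e = 1) : ∃ c : A, (c : ℂ) = a + (a' - a) * (e.1 : ℝ) := by
      rcases he with rfl | rfl
      · exact ⟨⟨a, ha⟩, by simp⟩
      · exact ⟨⟨a', ha'⟩, by simp⟩
    obtain ⟨c, hc⟩ := digit he
    obtain ⟨d, hd'⟩ := digit hf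
    refine ⟨s ++ [(c, d)], by simp [hs], ?_⟩
    rw [wordDiff_append, hd]
    simp [wordDiff, betaEval, hc, hd', gen]
    ring

theorem exists_finset_of_isRegular (h : IsSalemPair β α) (hA : 2 ≤ A.card)
    (hreg : (relLang (β : ℂ) A).IsRegular) :
    ∃ Δ : Finset Emb, ∀ n, ∀ x ∈ digitValues (gen β α) n, ∀ x' ∈ digitValues (gen β α) n,
      Collide (gen β α) x x' → x - x' ∈ Δ := by
  obtain ⟨a, ha, a', ha', hne⟩ := Finset.one_lt_card.1 hA
  have hβ : (β : ℂ) ≠ 0 := by exact_mod_cast (by linarith [h.one_lt] : β ≠ 0)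
  have hfin : {D : Emb | ∃ n, ∃ x ∈ digitValues (gen β α) n, ∃ x' ∈ digitValues (gen β α) n,
      Collide (gen β α) x x' ∧ x - x' = D}.Finite := by
    refine Set.Finite.of_injOn (f := fun D : Emb => (a' - a) * (D.1 : ℂ)) ?_ ?_
      (finite_wordDiff_of_isRegular hβ hreg)
    · rintro _ ⟨n, x, hx, x', hx', ⟨m, p, hp, p', hp', hc⟩, rfl⟩
      obtain ⟨w, -, hw⟩ := exists_wordDiff_eq ha ha' hx hx'
      obtain ⟨s, hsl, hs⟩ := exists_wordDiff_eq ha ha' hp hp'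
      refine ⟨w, s, ?_, hw⟩
      rw [mem_relLang_iff, wordDiff_append, hw, hs, hsl]
      have := congrArg (fun D : Emb => (D.1 : ℂ)) hc
      simp [gen] at this
      push_cast
      linear_combination (a' - a) * this
    · rintro _ ⟨n, x, hx, x', hx', -, rfl⟩ _ ⟨n', z, hz, z', hz', -, rfl⟩ heq
      have h1 := mul_left_cancel₀ (sub_ne_zero.2 hne.symm) heq
      have h2 : (x - x').1 = (z - z').1 := by exact_mod_cast h1
      have hl {n : ℕ} {x x' : Emb} (hx : x ∈ digitValues (gen β α) n)
          (hx' : x' ∈ digitValues (gen β α) n) : x - x' ∈ lattice β α :=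
        sub_mem (h.mem_lattice_of_mem_digitValues hx) (h.mem_lattice_of_mem_digitValues hx')
      exact sub_eq_zero.1 (h.eq_zero_of_fst_eq_zero (sub_mem (hl hx hx') (hl hz hz'))
        (by rw [Prod.fst_sub, h2, sub_self]))
  exact ⟨hfin.toFinset, fun n x hx x' hx' hc =>
    hfin.mem_toFinset.2 ⟨n, x, hx, x', hx', hc, rfl⟩⟩

end IsSalemPair

/-- For the Salem number `β`, the unique real root greater than `1` of
`X⁴ - 2X³ + X² - 2X + 1`, and every finite digit set `A ⊆ ℂ` with at least two elements,
the relation language `L(β, A)` is not regular: no such semigroup of affine maps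
`x ↦ βx + t`, `t ∈ A`, is strongly automatic. -/
theorem salem_relLang_not_isRegular_of_two_le_card (β : ℝ) (hβ : 1 < β)
    (hroot : β ^ 4 - 2 * β ^ 3 + β ^ 2 - 2 * β + 1 = 0)
    (A : Finset ℂ) (hA : 2 ≤ A.card) :
    ¬ (relLang (β : ℂ) A).IsRegular := by
  intro hreg
  obtain ⟨α, h⟩ := exists_isSalemPair hβ hroot
  obtain ⟨Δ, hΔ⟩ := h.exists_finset_of_isRegular hA hreg
  exact h.false_of_forall_collide Δ hΔ
end

section
/- Consider the three maps g₀, g₁, g₃ : ℝ → ℝ given by g₀(x) = x/3, g₁(x) = x/3 + 1, g₃(x) = x/3 + 3, indexed by the letters 0, 1, 3. For two words u = u₁⋯uₙ and v = v₁⋯vₘ over the alphabet {0, 1, 3}, the compositions g_{u₁} ∘ ⋯ ∘ g_{uₙ} and g_{v₁} ∘ ⋯ ∘ g_{vₘ} are equal as functions ℝ → ℝ if and only if u and v are related by the equivalence relation on words generated by replacing a factor of two consecutive letters '1,0' by '0,3' (and conversely). In other words, the semigroup generated by g₀, g₁, g₃ admits the presentation ⟨0, 1, 3 | 1∘0 =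 0∘3⟩. -/
/-- The affine map `x ↦ x/3 + i` on `ℝ` associated to the digit `i` (for digits
`i ∈ {0, 1, 3}` these are the three generators `g₀, g₁, g₃`). -/
noncomputable def digitMap (i : ℕ) : ℝ → ℝ := fun x => x / 3 + i

/-- The composition `g_{w₁} ∘ g_{w₂} ∘ ⋯ ∘ g_{wₙ}` represented by a word `w`. -/
noncomputable def evalWord (w : List ℕ) : ℝ → ℝ := (w.map digitMap).foldr (· ∘ ·) id

/-- One rewriting step: replace a factor `1,0` by the factor `0,3`. -/
def rwStep (u v : List ℕ) : Prop :=
  ∃ p s : List ℕ, u = p ++ [1, 0] ++ s ∧ v = p ++ [0, 3] ++ s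

/-- A word of length `n` represents the affine map `x ↦ (x + 3 * D) / 3 ^ n`, where `D` is the
number whose ternary digits (most significant first) are the letters of the word. -/
lemma evalWord_apply (w : List ℕ) (x : ℝ) :
    evalWord w x = (x + 3 * (Nat.ofDigits 3 w.reverse : ℕ)) / 3 ^ w.length := by
  induction w with
  | nil => simp [evalWord]
  | cons i w ih =>
    have h : evalWord (i :: w) x = evalWord w x / 3 + i := rfl
    rw [h, ih, List.reverse_cons, Nat.ofDigits_append, Nat.ofDigits_singleton,
      List.length_reverse, List.length_cons]
    push_cast
    field_simp
    ring

lemma evalWord_eq_iff (u v : List ℕ) :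
    evalWord u = evalWord v ↔
      u.length = v.length ∧ Nat.ofDigits 3 u.reverse = Nat.ofDigits 3 v.reverse := by
  refine ⟨fun h => ?_, fun ⟨hl, hd⟩ => funext fun x => by
    rw [evalWord_apply, evalWord_apply, hl, hd]⟩
  have h0 := congrFun h 0
  have h1 := congrFun h 1
  simp only [evalWord_apply, add_div, zero_add] at h0 h1
  rw [h0, add_left_inj, one_div, one_div, inv_inj] at h1
  have hl : u.length = v.length := Nat.pow_right_injective (by norm_num)
    (by exact_mod_cast h1 : (3 : ℕ) ^ u.length = 3 ^ v.length)
  refine ⟨hl, ?_⟩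
  rw [hl, div_left_inj' (by positivity)] at h0
  exact_mod_cast mul_left_cancel₀ (by norm_num) h0

lemma rwStep.evalWord_eq {u v : List ℕ} (h : rwStep u v) : evalWord u = evalWord v := by
  obtain ⟨p, s, rfl, rfl⟩ := h
  rw [evalWord_eq_iff]
  simp only [List.length_append, List.length_cons, List.length_nil, List.reverse_append,
    List.reverse_cons, List.reverse_nil, List.nil_append, List.cons_append,
    Nat.ofDigits_append, Nat.ofDigits_cons, List.length_reverse, true_and]
  ring

lemma eqvGen_rwStep_append_right {u v : List ℕ} (h : Relation.EqvGen rwStep u v) (t : List ℕ) :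
    Relation.EqvGen rwStep (u ++ t) (v ++ t) := by
  induction h with
  | rel u v h =>
    obtain ⟨p, s, rfl, rfl⟩ := h
    exact .rel _ _ ⟨p, s ++ t, by simp, by simp⟩
  | refl u => exact .refl _
  | symm u v _ ih => exact ih.symm
  | trans u v w _ _ ih₁ ih₂ => exact ih₁.trans _ _ _ ih₂

/-- If the least significant digits of two equal numbers are `0` and `3`, then the next digit of
the first number is `1`. -/
lemma exists_eq_one_cons_of_ofDigits_eq_succ {a b : List ℕ}
    (ha : ∀ i ∈ a, i ∈ ({0, 1, 3} : Set ℕ)) (hb : ∀ i ∈ b, i ∈ ({0, 1, 3} : Set ℕ))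
    (h : Nat.ofDigits 3 a = Nat.ofDigits 3 b + 1) : ∃ c, a = 1 :: c := by
  cases a with
  | nil => simp at h
  | cons i c =>
    have hi := ha i (by simp)
    cases b with
    | nil =>
      simp only [Nat.ofDigits_cons, Nat.ofDigits_nil] at h
      rcases hi with rfl | rfl | rfl
      · omega
      · exact ⟨c, rfl⟩
      · omega
    | cons j d =>
      have hj := hb j (by simp)
      simp only [Nat.ofDigits_cons] at h
      rcases hi with rfl | rfl | rfl
      · rcases hj with rfl | rfl | rfl <;> omega
      · exact ⟨c, rfl⟩
      · rcases hj with rfl | rfl | rfl <;> omega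

lemma eqvGen_reverse_of_ofDigits_eq (n : ℕ) : ∀ a b : List ℕ,
    (∀ i ∈ a, i ∈ ({0, 1, 3} : Set ℕ)) → (∀ i ∈ b, i ∈ ({0, 1, 3} : Set ℕ)) →
    a.length = n → b.length = n → Nat.ofDigits 3 a = Nat.ofDigits 3 b →
    Relation.EqvGen rwStep a.reverse b.reverse := by
  induction n with
  | zero =>
    intro a b _ _ hla hlb _
    rw [List.eq_nil_of_length_eq_zero hla, List.eq_nil_of_length_eq_zero hlb]
    exact .refl _
  | succ n ih =>
    have carry : ∀ a b : List ℕ,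
        (∀ i ∈ a, i ∈ ({0, 1, 3} : Set ℕ)) → (∀ i ∈ b, i ∈ ({0, 1, 3} : Set ℕ)) →
        a.length = n → b.length = n → Nat.ofDigits 3 a = Nat.ofDigits 3 b + 1 →
        Relation.EqvGen rwStep (0 :: a).reverse (3 :: b).reverse := by
      intro a b ha hb hla hlb h
      obtain ⟨c, rfl⟩ := exists_eq_one_cons_of_ofDigits_eq_succ ha hb h
      have hc : ∀ i ∈ 0 :: c, i ∈ ({0, 1, 3} : Set ℕ) := by
        intro i hi
        rcases List.mem_cons.1 hi with rfl | hi
        · simp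
        · exact ha i (List.mem_cons_of_mem _ hi)
      have key := ih (0 :: c) b hc hb (by simpa using hla) hlb (by
        simp only [Nat.ofDigits_cons] at h ⊢
        omega)
      refine .trans _ (c.reverse ++ [0, 3]) _ (.rel _ _ ⟨c.reverse, [], by simp, by simp⟩) ?_
      simpa using eqvGen_rwStep_append_right key [3]
    intro a b hia hjb hla hlb h
    obtain ⟨i, a, rfl⟩ := List.exists_cons_of_length_eq_add_one hla
    obtain ⟨j, b, rfl⟩ := List.exists_cons_of_length_eq_add_one hlb
    obtain ⟨hi, ha⟩ := List.forall_mem_cons.1 hia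
    obtain ⟨hj, hb⟩ := List.forall_mem_cons.1 hjb
    replace hla : a.length = n := by simpa using hla
    replace hlb : b.length = n := by simpa using hlb
    simp only [Nat.ofDigits_cons] at h
    by_cases hij : i = j
    · subst hij
      simpa using eqvGen_rwStep_append_right (ih a b ha hb hla hlb (by omega)) [i]
    · rcases hi with rfl | rfl | rfl <;> rcases hj with rfl | rfl | rfl <;>
        first
        | omega
        | exact carry a b ha hb hla hlb (by omega)
        | exact (carry b a hb ha hlb hla (by omega)).symm

/-- Two words over the alphabet `{0, 1, 3}` represent the same composition of the maps
`g₀, g₁, g₃` iff they are related by the equivalence relation generated by replacing a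
factor `1,0` by `0,3`: the semigroup has the presentation `⟨0, 1, 3 ∣ 1∘0 = 0∘3⟩`. -/
theorem evalWord_eq_iff_eqvGen (u v : List ℕ)
    (hu : ∀ i ∈ u, i ∈ ({0, 1, 3} : Set ℕ)) (hv : ∀ i ∈ v, i ∈ ({0, 1, 3} : Set ℕ)) :
    evalWord u = evalWord v ↔ Relation.EqvGen rwStep u v := by
  constructor
  · intro h
    obtain ⟨hl, hd⟩ := (evalWord_eq_iff u v).1 h
    simpa using eqvGen_reverse_of_ofDigits_eq v.length u.reverse v.reverse
      (by simpa using hu) (by simpa using hv) (by simpa using hl) (by simp) hd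
  · intro h
    clear hu hv
    induction h with
    | rel u v h => exact h.evalWord_eq
    | refl u => rfl
    | symm u v _ ih => exact ih.symm
    | trans u v w _ _ ih₁ ih₂ => exact ih₁.trans ih₂
end
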